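/- Suppose p ≥ 1/2 and β ∈ [0,1], and fix any initial configuration ξ₀ = S₀ ∈ 𝒟. Then for every t ∈ ℕ, Pr_{β,p}( max_{0 ≤ s ≤ t} |ξ_s| ≤ 2√10 · t^{1/2} ) ≥ 0.95 − f₂(S₀)/(10t). -/

import Mathlib

open MeasureTheory Filter
open scoped ENNReal NNReal

namespace EV

/-- A configuration of the exclusion-voter model is the finite hybrid-zone word
(`false` = 0, `true` = 1); the full two-sided configuration is `1^∞ w 0^∞`. -/
abbrev Word := List Bool

/-- Canonical (normalized) words: empty (the ground state `𝒟₀`) or starting with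
a `0` and ending with a `1`; these are in bijection with the configuration space `𝒟`. -/
def IsConfig (w : Word) : Prop :=
  w = [] ∨ (w.head? = some false ∧ w.getLast? = some true)

/-- The ground-state Heaviside configuration `𝒟₀ = …111000…`. -/
def groundState : Word := []

/-- Pad a word with one boundary symbol of the adjacent infinite block on each side. -/
def pad (w : Word) : Word := true :: (w ++ [false])

/-- Normalize: strip leading `1`s (they merge into the left infinite block of `1`s)
and trailing `0`s (they merge into the right infinite block of `0`s). -/
def strip (w : Word) : Word :=
  ((w.dropWhile (· = true)).reverse.dropWhile (· = false)).reverse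

def setPair (w : Word) (i : ℕ) (a b : Bool) : Word := (w.set i a).set (i + 1) b

def swapPair (w : Word) (i : ℕ) : Word :=
  setPair w i (w.getD (i + 1) true) (w.getD i true)

/-- Indices of the unlike adjacent pairs (`01` or `10`), read off the padded word. -/
def unlike (w : Word) : List ℕ :=
  (List.range (w.length + 1)).filter
    (fun i => (pad w).getD i true ≠ (pad w).getD (i + 1) true)

/-- One-step transition kernel of the discrete-time exclusion-voter chain with mixing
parameter `β` and exclusion parameter `p`: an unlike adjacent pair is chosen uniformly
at random; with probability `β` a voter move flips the pair to `00` or `11` (each with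
probability `1/2`); with probability `1-β` an exclusion move swaps a `01` with
probability `p` and a `10` with probability `1-p` (otherwise no change). -/
noncomputable def P (β p : ℝ) (w w' : Word) : ℝ :=
  ((unlike w).map (fun i =>
    let a := (pad w).getD i true
    let swapProb := if a then 1 - p else p
    ((unlike w).length : ℝ)⁻¹ *
      (β * (1 / 2) * (if strip (setPair (pad w) i false false) = w' then 1 else 0)
       + β * (1 / 2) * (if strip (setPair (pad w) i true true) = w' then 1 else 0)
       + (1 - β) * swapProb * (if strip (swapPair (pad w) i) = w' then 1 else 0)
       + (1 - β) * (1 - swapProb) * (if w = w' then 1 else 0)))).sum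

/-- `n`-step transition probabilities. -/
noncomputable def Pn (β p : ℝ) : ℕ → Word → Word → ℝ
  | 0 => fun w w' => if w = w' then 1 else 0
  | n + 1 => fun w w' => ∑' z : Word, Pn β p n w z * P β p z w'

/-- `w'` is accessible from `w`: some `n`-step transition probability is positive. -/
def Accessible (β p : ℝ) (w w' : Word) : Prop :=
  ∃ n : ℕ, 0 < n ∧ 0 < Pn β p n w w'

/-- Two states communicate: each is accessible from the other. -/
def Communicate (β p : ℝ) (w w' : Word) : Prop :=
  Accessible β p w w' ∧ Accessible β p w' w

instance : MeasurableSpace Word := ⊤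

/-- `ξ` is (a realization of) the discrete-time exclusion-voter Markov chain with
parameters `(β, p)` under the probability measure `μ`. -/
def IsEVChain (β p : ℝ) {Ω : Type*} [MeasurableSpace Ω] (μ : Measure Ω)
    (ξ : ℕ → Ω → Word) : Prop :=
  (∀ t, Measurable (ξ t)) ∧
  ∀ (t : ℕ) (path : ℕ → Word),
    μ {ω | ∀ i ≤ t + 1, ξ i ω = path i}
      = μ {ω | ∀ i ≤ t, ξ i ω = path i} * ENNReal.ofReal (P β p (path t) (path (t + 1)))

/-- The relaxation time `τ = min {t ∈ ℕ, t ≥ 1 : ξ_t = 𝒟₀}` (`∞` if there is no such `t`). -/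
noncomputable def relaxTime {Ω : Type*} (ξ : ℕ → Ω → Word) (ω : Ω) : ℝ≥0∞ :=
  sInf {r : ℝ≥0∞ | ∃ t : ℕ, 0 < t ∧ ξ t ω = groundState ∧ r = (t : ℝ≥0∞)}

/-- The size `|S|` of the hybrid zone. -/
def hz (w : Word) : ℕ := w.length

/-- The number of blocks `N(S)`: the number of (finite) `1`-blocks of the hybrid zone. -/
def nb (w : Word) : ℕ :=
  ((Finset.range w.length).filter
    (fun b => w.getD b false = true ∧ (b = 0 ∨ w.getD (b - 1) true = false))).card

/-- Number of `0`s among the first `c` positions of the hybrid zone. -/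
def z0 (w : Word) (c : ℕ) : ℕ :=
  ((Finset.range c).filter (fun a => w.getD a true = false)).card

/-- Number of `1`s of the hybrid zone at positions `≥ c`. -/
def o1 (w : Word) (c : ℕ) : ℕ :=
  ((Finset.Ico c w.length).filter (fun b => w.getD b false = true)).card

/-- `f₁(S) = Σᵢ mᵢ Rᵢ = Σᵢ nᵢ Tᵢ`: each `1` contributes the number of `0`s to its left. -/
def f1 (w : Word) : ℕ :=
  ∑ b ∈ (Finset.range w.length).filter (fun b => w.getD b false = true), z0 w b

/-- `f₂(S) = (1/2)(Σᵢ mᵢ Rᵢ² + Σᵢ nᵢ Tᵢ²)`: each `1` contributes the squared number of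
`0`s to its left, each `0` the squared number of `1`s to its right. -/
noncomputable def f2 (w : Word) : ℝ :=
  (1 / 2) *
    ((∑ b ∈ (Finset.range w.length).filter (fun b => w.getD b false = true),
        ((z0 w b : ℝ)) ^ 2)
     + (∑ a ∈ (Finset.range w.length).filter (fun a => w.getD a true = false),
        ((o1 w (a + 1) : ℝ)) ^ 2))

/-- `g(S) = max_{1 ≤ k ≤ N} R_k T_k`: the maximum over the `01`-corners of
(number of `0`s up to the corner) × (number of `1`s after the corner). -/
def gfun (w : Word) : ℕ :=
  ((Finset.range w.length).filter
    (fun a => w.getD a true = false ∧ w.getD (a + 1) false = true)).sup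
    (fun a => z0 w (a + 1) * o1 w (a + 1))

/-- `φ₁(S) = Σᵢ Σ_{j=R_{i-1}+1}^{R_i} Σ_{k=1}^{T_i} 1/(j+k)`: the `j`-th `0` (at position `a`,
so `j = z0 w (a+1)`) contributes `Σ_{k=1}^{T} 1/(j+k)` with `T` the number of `1`s to its right. -/
noncomputable def phi1 (w : Word) : ℝ :=
  ∑ a ∈ (Finset.range w.length).filter (fun a => w.getD a true = false),
    ∑ k ∈ Finset.Icc 1 (o1 w (a + 1)), (1 : ℝ) / ((z0 w (a + 1) : ℝ) + (k : ℝ))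


/-! ### Recursive description of `f2` -/

/-- List recursion for the number of `0`-before-`1` inversions. -/
def inversions : List Bool → ℝ
  | [] => 0
  | true :: w => inversions w
  | false :: w => inversions w + w.count true

/-- List recursion computing `f2`. -/
noncomputable def energy : List Bool → ℝ
  | [] => 0
  | true :: w => energy w
  | false :: w =>
      energy w + 1 / 2 * ((w.count true : ℝ) + 2 * inversions w + (w.count true : ℝ) ^ 2)

lemma z0_cons_succ (x : Bool) (w : Word) (c : ℕ) :
    z0 (x :: w) (c + 1) = (if x = false then 1 else 0) + z0 w c := by
  simp only [z0, Finset.card_filter, Finset.sum_range_succ', List.getD_cons_succ,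
    List.getD_cons_zero]
  ring

lemma o1_cons_succ (x : Bool) (w : Word) (c : ℕ) : o1 (x :: w) (c + 1) = o1 w c := by
  simp only [o1, Finset.card_filter, List.length_cons, ← Finset.sum_Ico_add' _ c w.length 1,
    List.getD_cons_succ]

lemma o1_zero (w : Word) : o1 w 0 = w.count true := by
  induction w with
  | nil => simp [o1]
  | cons x w ih =>
    rw [o1, Finset.card_filter, List.length_cons, ← Finset.range_eq_Ico,
      Finset.sum_range_succ', List.count_cons, ← ih, o1, Finset.card_filter,
      ← Finset.range_eq_Ico]
    cases x <;> simp

/-- The sum of `F (z0 w b)` over the positions `b` of the `1`s. -/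
lemma sum_ones_cons (F : ℕ → ℝ) (x : Bool) (w : Word) :
    ∑ b ∈ (Finset.range (x :: w).length).filter (fun b => (x :: w).getD b false = true),
        F (z0 (x :: w) b)
      = (if x = true then F 0 else 0)
        + ∑ b ∈ (Finset.range w.length).filter (fun b => w.getD b false = true),
            F ((if x = false then 1 else 0) + z0 w b) := by
  rw [Finset.sum_filter, Finset.sum_filter, List.length_cons, Finset.sum_range_succ', add_comm]
  simp only [List.getD_cons_succ, List.getD_cons_zero, z0_cons_succ]
  simp [z0]

/-- The sum of `F (o1 w (a + 1))` over the positions `a` of the `0`s. -/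
lemma sum_zeros_cons (F : ℕ → ℝ) (x : Bool) (w : Word) :
    ∑ a ∈ (Finset.range (x :: w).length).filter (fun a => (x :: w).getD a true = false),
        F (o1 (x :: w) (a + 1))
      = (if x = false then F (w.count true) else 0)
        + ∑ a ∈ (Finset.range w.length).filter (fun a => w.getD a true = false),
            F (o1 w (a + 1)) := by
  rw [Finset.sum_filter, Finset.sum_filter, List.length_cons, Finset.sum_range_succ', add_comm]
  simp only [List.getD_cons_succ, List.getD_cons_zero, o1_cons_succ, o1_zero]

lemma card_ones (w : Word) :
    ((Finset.range w.length).filter (fun b => w.getD b false = true)).card = w.count true := by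
  rw [← o1_zero, o1, Finset.range_eq_Ico]

lemma sum_z0_eq_inversions (w : Word) :
    ∑ b ∈ (Finset.range w.length).filter (fun b => w.getD b false = true), (z0 w b : ℝ)
      = inversions w := by
  induction w with
  | nil => simp [inversions]
  | cons x w ih =>
    rw [sum_ones_cons (fun n => (n : ℝ))]
    cases x
    · simp [Finset.sum_add_distrib, ih, inversions, -List.getD_eq_getElem?_getD, card_ones,
        add_comm]
    · simp [ih, inversions, -List.getD_eq_getElem?_getD]

lemma f2_eq_energy (w : Word) : f2 w = energy w := by
  induction w with
  | nil => simp [f2, energy]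
  | cons x w ih =>
    rw [f2, sum_ones_cons (fun n => (n : ℝ) ^ 2), sum_zeros_cons (fun n => (n : ℝ) ^ 2)]
    cases x
    · rw [energy, ← ih, f2]
      have h : ∀ n : ℕ, ((1 + n : ℕ) : ℝ) ^ 2 = 1 + 2 * (n : ℝ) + (n : ℝ) ^ 2 := by
        intro n
        push_cast
        ring
      simp only [if_true, h, Finset.sum_add_distrib, ← Finset.mul_sum, sum_z0_eq_inversions]
      simp only [Finset.sum_const, card_ones]
      simp
      ring
    · rw [energy, ← ih, f2]
      simp

lemma inversions_nonneg (w : Word) : 0 ≤ inversions w := by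
  induction w with
  | nil => simp [inversions]
  | cons x w ih => cases x <;> simp only [inversions] <;> positivity

lemma energy_nonneg (w : Word) : 0 ≤ energy w := by
  induction w with
  | nil => simp [energy]
  | cons x w ih =>
    have := inversions_nonneg w
    cases x <;> simp only [energy] <;> positivity

lemma inversions_append (u v : Word) :
    inversions (u ++ v) = inversions u + inversions v + u.count false * v.count true := by
  induction u with
  | nil => simp [inversions]
  | cons x u ih =>
    cases x <;> simp [inversions, ih]
    ring

lemma energy_append (u v : Word) :
    energy (u ++ v) = energy u + energy v
      + 1 / 2 * ((v.count true : ℝ) * (u.count false : ℝ) ^ 2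
        + 2 * u.count false * inversions v
        + u.count false * (v.count true : ℝ) ^ 2 + 2 * v.count true * inversions u) := by
  induction u with
  | nil => simp [energy, inversions]
  | cons x u ih =>
    cases x
    · simp [energy, inversions, ih, inversions_append]
      ring
    · simp [energy, inversions, ih]

lemma energy_pad (w : Word) : energy (pad w) = energy w := by
  simp [pad, energy, energy_append, inversions]

lemma strip_eq_rdropWhile (w : Word) :
    strip w = (w.dropWhile (· = true)).rdropWhile (· = false) := rfl

lemma energy_dropWhile (w : Word) : energy (w.dropWhile (· = true)) = energy w := by
  induction w with
  | nil => rfl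
  | cons x w ih =>
    cases x
    · simp
    · simpa [energy] using ih

lemma energy_rdropWhile (w : Word) : energy (w.rdropWhile (· = false)) = energy w := by
  induction w using List.reverseRecOn with
  | nil => rfl
  | append_singleton w x ih =>
    cases x
    · rw [List.rdropWhile_concat_pos _ _ _ (by simp), ih]
      simp [energy_append, energy, inversions]
    · rw [List.rdropWhile_concat_neg _ _ _ (by simp)]

lemma energy_strip (w : Word) : energy (strip w) = energy w := by
  rw [strip_eq_rdropWhile, energy_rdropWhile, energy_dropWhile]

/-! ### Canonical words -/

lemma isConfig_strip (w : Word) : IsConfig (strip w) := by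
  by_cases h : strip w = []
  · exact Or.inl h
  refine Or.inr ⟨?_, ?_⟩
  · rw [strip_eq_rdropWhile] at h ⊢
    have hpre := List.rdropWhile_prefix (fun x : Bool => decide (x = false))
      (l := w.dropWhile (· = true))
    have hne : w.dropWhile (· = true) ≠ [] := fun h0 => h (by rw [h0]; rfl)
    have hd := List.head_dropWhile_not (fun x : Bool => decide (x = true)) hne
    rw [List.head?_eq_some_head h, hpre.head h]
    simpa using hd
  · rw [strip_eq_rdropWhile] at h ⊢
    have hl := List.rdropWhile_last_not (fun x : Bool => decide (x = false))
      (w.dropWhile (· = true)) h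
    rw [List.getLast?_eq_some_getLast h]
    simpa using hl

lemma sq_length_le_energy {w : Word} (hw : IsConfig w) : (w.length : ℝ) ^ 2 ≤ 4 * energy w := by
  rcases hw with rfl | ⟨hh, hl⟩
  · simp [energy]
  obtain ⟨v, rfl⟩ : ∃ v, w = false :: v := by
    cases w with
    | nil => simp at hh
    | cons x v => exact ⟨v, by simpa using hh⟩
  obtain ⟨u, rfl⟩ : ∃ u, v = u ++ [true] := by
    rcases List.eq_nil_or_concat v with rfl | ⟨u, x, rfl⟩
    · simp at hl
    · refine ⟨u, ?_⟩
      simp_all [List.getLast?_cons]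
  have h1 := inversions_nonneg u
  have h2 := energy_nonneg u
  have hlen : (u.length : ℝ) = u.count false + u.count true := by
    rw [← List.count_false_add_count_true u]
    push_cast
    ring
  have h3 : (0 : ℝ) ≤ u.count false := by positivity
  have h4 : (0 : ℝ) ≤ u.count true := by positivity
  simp [energy, inversions, energy_append, inversions_append, hlen]
  nlinarith [sq_nonneg ((u.count false : ℝ) - u.count true)]

/-! ### Local moves -/

/-- Zeros to the left plus ones to the right of the cut at `j`. -/
def cutWeight (u : Word) (j : ℕ) : ℝ := (u.take j).count false + (u.drop j).count true

/-- The numerical value of the symbol at position `i`. -/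
def bit (u : Word) (i : ℕ) : ℝ := if u.getD i true then 1 else 0

lemma eq_append_pair {u : Word} {i : ℕ} (hi : i + 1 < u.length) :
    ∃ A x y B, u = A ++ x :: y :: B ∧ A.length = i := by
  refine ⟨u.take i, u[i], u[i + 1], u.drop (i + 2), ?_, by simp; omega⟩
  rw [List.getElem_cons_drop, List.getElem_cons_drop, List.take_append_drop]

lemma setPair_append (A B : Word) (x y a b : Bool) :
    setPair (A ++ x :: y :: B) A.length a b = A ++ a :: b :: B := by
  simp [setPair]

lemma energy_setPair_add {u : Word} {i : ℕ} (hi : i + 1 < u.length)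
    (hne : u.getD i true ≠ u.getD (i + 1) true) :
    energy (setPair u i false false) + energy (setPair u i true true)
      = 2 * energy u + (bit u i - bit u (i + 1)) * cutWeight u (i + 1) := by
  obtain ⟨A, x, y, B, rfl, rfl⟩ := eq_append_pair hi
  rw [setPair_append, setPair_append]
  cases x <;> cases y <;>
    simp [energy_append, energy, inversions, bit, cutWeight, List.take_append,
      List.drop_append, List.take_of_length_le, List.drop_of_length_le] at hne ⊢ <;>
    ring

lemma energy_swapPair {u : Word} {i : ℕ} (hi : i + 1 < u.length)
    (hne : u.getD i true ≠ u.getD (i + 1) true) :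
    energy (swapPair u i)
      = energy u + 1 + (bit u i - bit u (i + 1)) * cutWeight u (i + 1) := by
  obtain ⟨A, x, y, B, rfl, rfl⟩ := eq_append_pair hi
  rw [swapPair, setPair_append]
  cases x <;> cases y <;>
    simp [energy_append, energy, inversions, bit, cutWeight, List.take_append,
      List.drop_append, List.take_of_length_le, List.drop_of_length_le] at hne ⊢ <;>
    ring

lemma cutWeight_nonneg (u : Word) (j : ℕ) : 0 ≤ cutWeight u j := by
  unfold cutWeight
  positivity

lemma one_le_cutWeight {u : Word} {i : ℕ} (hi : i < u.length) (h : u.getD i true = false) :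
    1 ≤ cutWeight u (i + 1) := by
  have hu : u[i] = false := by simpa [hi] using h
  have : 1 ≤ (u.take (i + 1)).count false := by
    rw [List.take_succ_eq_append_getElem hi, hu]
    simp
  have : (1 : ℝ) ≤ (u.take (i + 1)).count false := by exact_mod_cast this
  unfold cutWeight
  have : (0 : ℝ) ≤ (u.drop (i + 1)).count true := by positivity
  linarith

lemma sum_bit_sub_mul_cutWeight (u : Word) {n : ℕ} (hn : n ≤ u.length) :
    ∑ i ∈ Finset.range n, (bit u i - bit u (i + 1)) * cutWeight u (i + 1)
      = bit u 0 * cutWeight u 0 - bit u n * cutWeight u n - (u.take n).count true := by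
  induction n with
  | zero => simp
  | succ n ih =>
    have hlt : n < u.length := hn
    rw [Finset.sum_range_succ, ih hlt.le]
    have hd := List.drop_eq_getElem_cons hlt
    have ht := List.take_succ_eq_append_getElem hlt
    cases hx : u[n] <;>
      simp [bit, cutWeight, hd, ht, hx, hlt] <;>
      split_ifs <;> ring

lemma length_pad (w : Word) : (pad w).length = w.length + 2 := by simp [pad]

lemma sum_unlike_eq_zero (w : Word) :
    ((unlike w).map (fun i => (bit (pad w) i - bit (pad w) (i + 1))
      * cutWeight (pad w) (i + 1))).sum = 0 := by
  have hsum : ((unlike w).map (fun i => (bit (pad w) i - bit (pad w) (i + 1))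
      * cutWeight (pad w) (i + 1))).sum
      = ∑ i ∈ Finset.range (w.length + 1), (bit (pad w) i - bit (pad w) (i + 1))
        * cutWeight (pad w) (i + 1) := by
    have hnd : (unlike w).Nodup := List.nodup_range.filter _
    rw [← List.sum_toFinset _ hnd]
    refine Finset.sum_subset (fun i hi => ?_) (fun i hi hi' => ?_)
    · simp only [unlike, List.mem_toFinset, List.mem_filter, List.mem_range] at hi
      simpa using hi.1
    · have : (pad w).getD i true = (pad w).getD (i + 1) true := by
        by_contra hne
        refine hi' ?_
        simp only [unlike, List.mem_toFinset, List.mem_filter, List.mem_range]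
        exact ⟨Finset.mem_range.1 hi, by simpa using hne⟩
      simp only [bit, this, sub_self, zero_mul]
  rw [hsum, sum_bit_sub_mul_cutWeight _ (by rw [length_pad]; omega)]
  simp [pad, bit, cutWeight]

/-! ### One-step drift -/

lemma mem_unlike {w : Word} {i : ℕ} (hi : i ∈ unlike w) :
    i + 1 < (pad w).length ∧ (pad w).getD i true ≠ (pad w).getD (i + 1) true := by
  simp only [unlike, List.mem_filter, List.mem_range, decide_eq_true_eq] at hi
  exact ⟨by rw [length_pad]; omega, hi.2⟩

/-- The mean of `F` after a move at the unlike pair `i`. -/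
noncomputable def moveMean (β p : ℝ) (F : Word → ℝ) (w : Word) (i : ℕ) : ℝ :=
  let swapProb := if (pad w).getD i true then 1 - p else p
  β * (1 / 2) * F (strip (setPair (pad w) i false false))
    + β * (1 / 2) * F (strip (setPair (pad w) i true true))
    + (1 - β) * swapProb * F (strip (swapPair (pad w) i))
    + (1 - β) * (1 - swapProb) * F w

lemma hasSum_list_sum {ι α : Type*} (l : List ι) (f : ι → α → ℝ) (a : ι → ℝ)
    (h : ∀ i ∈ l, HasSum (f i) (a i)) :
    HasSum (fun x => (l.map (fun i => f i x)).sum) (l.map a).sum := by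
  induction l with
  | nil => simp
  | cons i l ih =>
    simp only [List.map_cons, List.sum_cons]
    exact (h i (by simp)).add (ih fun j hj => h j (by simp [hj]))

lemma hasSum_P_mul (β p : ℝ) (F : Word → ℝ) (w : Word) :
    HasSum (fun w' => P β p w w' * F w')
      ((unlike w).map (fun i => ((unlike w).length : ℝ)⁻¹ * moveMean β p F w i)).sum := by
  have hpt : ∀ (c : ℝ) (v : Word),
      HasSum (fun w' => c * (if v = w' then 1 else 0) * F w') (c * F v) := by
    intro c v
    convert hasSum_ite_eq v (c * F v) using 2 with w'
    by_cases h : v = w'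
    · simp [h]
    · simp [h, Ne.symm h]
  simp only [P, ← List.sum_map_mul_right]
  refine hasSum_list_sum _ _ _ fun i _ => ?_
  simp only [mul_assoc _ _ (F _)]
  refine HasSum.mul_left _ ?_
  simp only [add_mul]
  exact (((hpt _ _).add (hpt _ _)).add (hpt _ _)).add (hpt _ _)

lemma moveMean_energy_le {β p : ℝ} (hβ0 : 0 ≤ β) (hβ1 : β ≤ 1) (hp : 1 / 2 ≤ p)
    {w : Word} {i : ℕ} (hi : i ∈ unlike w) :
    moveMean β p energy w i ≤ energy w + 1 / 2
      + 1 / 2 * ((bit (pad w) i - bit (pad w) (i + 1)) * cutWeight (pad w) (i + 1)) := by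
  obtain ⟨hlt, hne⟩ := mem_unlike hi
  have hvote := energy_setPair_add hlt hne
  have hswap := energy_swapPair hlt hne
  rw [energy_pad] at hvote hswap
  simp only [moveMean, energy_strip, hswap]
  rw [show ∀ a b c d e f g : ℝ, a * b * c + a * b * d + e * f + g = a * b * (c + d) + e * f + g
    by intros; ring, hvote]
  cases hx : (pad w).getD i true
  · have hy : (pad w).getD (i + 1) true = true := by
      rw [hx] at hne
      exact Bool.eq_true_of_not_eq_false hne.symm
    have hc := one_le_cutWeight (by omega) hx
    simp only [bit, hx, hy, if_true, Bool.false_eq_true, if_false]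
    nlinarith [mul_nonneg (mul_nonneg (sub_nonneg.2 hβ1) (sub_nonneg.2 hp)) (sub_nonneg.2 hc)]
  · have hy : (pad w).getD (i + 1) true = false := by
      rw [hx] at hne
      exact Bool.eq_false_of_not_eq_true hne.symm
    have hc := cutWeight_nonneg (pad w) (i + 1)
    simp only [bit, hx, hy, if_true, Bool.false_eq_true, if_false]
    nlinarith [mul_nonneg (mul_nonneg (sub_nonneg.2 hβ1) (sub_nonneg.2 hp))
      (add_nonneg hc zero_le_one)]

lemma energy_drift {β p : ℝ} (hβ0 : 0 ≤ β) (hβ1 : β ≤ 1) (hp : 1 / 2 ≤ p) (w : Word) :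
    ((unlike w).map (fun i => ((unlike w).length : ℝ)⁻¹ * moveMean β p energy w i)).sum
      ≤ energy w + 1 / 2 := by
  have hle := List.sum_le_sum fun i (hi : i ∈ unlike w) => moveMean_energy_le hβ0 hβ1 hp hi
  rw [List.sum_map_add, List.sum_map_mul_left, sum_unlike_eq_zero] at hle
  simp only [List.map_const', List.sum_replicate, nsmul_eq_mul, mul_zero, add_zero] at hle
  rw [List.sum_map_mul_left]
  have he := energy_nonneg w
  calc _ ≤ ((unlike w).length : ℝ)⁻¹ * ((unlike w).length * (energy w + 1 / 2)) := by gcongr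
    _ = ((unlike w).length : ℝ)⁻¹ * (unlike w).length * (energy w + 1 / 2) := by ring
    _ ≤ 1 * (energy w + 1 / 2) := by
      gcongr
      exact inv_mul_le_one
    _ = _ := one_mul _

lemma P_nonneg {β p : ℝ} (hβ0 : 0 ≤ β) (hβ1 : β ≤ 1) (hp : 0 ≤ p) (hp1 : p ≤ 1)
    (w w' : Word) : 0 ≤ P β p w w' := by
  refine List.sum_nonneg fun x hx => ?_
  obtain ⟨i, -, rfl⟩ := List.mem_map.1 hx
  have h1 : 0 ≤ 1 - β := by linarith
  have h2 : 0 ≤ 1 - p := by linarith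
  have h3 : ∀ q : Prop, ∀ [Decidable q], (0 : ℝ) ≤ if q then 1 else 0 := by
    intro q _
    split_ifs <;> simp
  have h4 : (0 : ℝ) ≤ if (pad w).getD i true then 1 - p else p := by split_ifs <;> assumption
  have h5 : (0 : ℝ) ≤ 1 - if (pad w).getD i true then 1 - p else p := by
    split_ifs <;> linarith
  have := h3 (strip (setPair (pad w) i false false) = w')
  have := h3 (strip (setPair (pad w) i true true) = w')
  have := h3 (strip (swapPair (pad w) i) = w')
  have := h3 (w = w')
  positivity

lemma P_eq_zero_of_not_isConfig (β p : ℝ) {w w' : Word} (hw : IsConfig w)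
    (hw' : ¬ IsConfig w') : P β p w w' = 0 := by
  have hs : ∀ v, strip v ≠ w' := fun v h => hw' (h ▸ isConfig_strip v)
  have hww : w ≠ w' := fun h => hw' (h ▸ hw)
  simp [P, hs, hww]

open Classical in
/-- The energy, set to `∞` off the canonical words. -/
noncomputable def potential (w : Word) : ℝ≥0∞ :=
  if IsConfig w then ENNReal.ofReal (energy w) else ⊤

lemma potential_drift {β p : ℝ} (hβ0 : 0 ≤ β) (hβ1 : β ≤ 1) (hp : 1 / 2 ≤ p) (hp1 : p ≤ 1)
    (w : Word) :
    ∑' w', ENNReal.ofReal (P β p w w') * potential w'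
      ≤ potential w + ENNReal.ofReal (1 / 2) := by
  by_cases hw : IsConfig w
  swap
  · simp [potential, hw]
  have hP := P_nonneg hβ0 hβ1 (by linarith : 0 ≤ p) hp1 w
  have hterm : ∀ w', ENNReal.ofReal (P β p w w') * potential w'
      = ENNReal.ofReal (P β p w w' * energy w') := by
    intro w'
    by_cases hw' : IsConfig w'
    · simp [potential, hw', ENNReal.ofReal_mul (hP w')]
    · simp [P_eq_zero_of_not_isConfig β p hw hw']
  have hs := hasSum_P_mul β p energy w
  simp only [hterm]
  rw [← ENNReal.ofReal_tsum_of_nonneg (fun w' => mul_nonneg (hP w') (energy_nonneg w'))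
    hs.summable, hs.tsum_eq, potential, if_pos hw,
    ← ENNReal.ofReal_add (energy_nonneg w) (by norm_num)]
  exact ENNReal.ofReal_le_ofReal (energy_drift hβ0 hβ1 hp w)

/-! ### A maximal inequality for countable Markov chains -/

section Maximal

variable {Ω α : Type*} [MeasurableSpace Ω] [Countable α] [MeasurableSpace α]
  [MeasurableSingletonClass α] {μ : Measure Ω} {ξ : ℕ → Ω → α} {Q : α → α → ℝ≥0∞}
  {V : α → ℝ≥0∞} {c : ℝ≥0∞}

lemma setLIntegral_cylinder_succ_le (hξ : ∀ t, Measurable (ξ t))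
    (hstep : ∀ (t : ℕ) (path : ℕ → α),
      μ {ω | ∀ i ≤ t + 1, ξ i ω = path i}
        = μ {ω | ∀ i ≤ t, ξ i ω = path i} * Q (path t) (path (t + 1)))
    (hdrift : ∀ x, ∑' y, Q x y * V y ≤ V x + c) (n : ℕ) (path : ℕ → α) :
    ∫⁻ ω in {ω | ∀ i ≤ n, ξ i ω = path i}, V (ξ (n + 1) ω) ∂μ
      ≤ ∫⁻ ω in {ω | ∀ i ≤ n, ξ i ω = path i}, (V (ξ n ω) + c) ∂μ := by
  set C := {ω | ∀ i ≤ n, ξ i ω = path i} with hC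
  have hCm : MeasurableSet C := by
    have : C = ⋂ i, ⋂ (_ : i ≤ n), ξ i ⁻¹' {path i} := by ext; simp [hC]
    rw [this]
    exact MeasurableSet.iInter fun i => MeasurableSet.iInter fun _ =>
      hξ i (measurableSet_singleton _)
  have hV : Measurable V := measurable_of_countable V
  have hR : ∫⁻ ω in C, (V (ξ n ω) + c) ∂μ = (V (path n) + c) * μ C := by
    rw [setLIntegral_congr_fun hCm (g := fun _ => V (path n) + c)
      (fun ω hω => by simp only [hω n le_rfl]), setLIntegral_const]
  have hL : ∫⁻ ω in C, V (ξ (n + 1) ω) ∂μ = μ C * ∑' y, Q (path n) y * V y := by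
    rw [← lintegral_map hV (hξ (n + 1)), lintegral_countable', ← ENNReal.tsum_mul_left]
    refine tsum_congr fun y => ?_
    rw [Measure.map_apply (hξ _) (measurableSet_singleton _),
      Measure.restrict_apply (hξ _ (measurableSet_singleton _))]
    have hext := hstep n (fun i => if i ≤ n then path i else y)
    have h1 : {ω | ∀ i ≤ n + 1, ξ i ω = if i ≤ n then path i else y}
        = ξ (n + 1) ⁻¹' {y} ∩ C := by
      ext ω
      simp only [hC, Set.mem_ofPred_eq, Set.mem_inter_iff, Set.mem_preimage,
        Set.mem_singleton_iff]
      constructor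
      · intro h
        exact ⟨by simpa using h (n + 1) le_rfl,
          fun i hi => by simpa [hi] using h i (by omega)⟩
      · rintro ⟨hy, h⟩ i hi
        rcases Nat.le_succ_iff.1 hi with hi' | rfl
        · simpa [hi'] using h i hi'
        · simpa using hy
    have h2 : {ω | ∀ i ≤ n, ξ i ω = if i ≤ n then path i else y} = C := by
      ext ω
      simp +contextual [hC]
    rw [h1, h2] at hext
    simp only [le_refl, if_true, Nat.not_succ_le_self, if_false] at hext
    rw [hext]
    ring
  rw [hL, hR, mul_comm]
  gcongr
  exact hdrift _

lemma setLIntegral_history_succ_le (hξ : ∀ t, Measurable (ξ t))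
    (hstep : ∀ (t : ℕ) (path : ℕ → α),
      μ {ω | ∀ i ≤ t + 1, ξ i ω = path i}
        = μ {ω | ∀ i ≤ t, ξ i ω = path i} * Q (path t) (path (t + 1)))
    (hdrift : ∀ x, ∑' y, Q x y * V y ≤ V x + c) (n : ℕ) (A : Set α) :
    ∫⁻ ω in {ω | ∀ i ≤ n, ξ i ω ∈ A}, V (ξ (n + 1) ω) ∂μ
      ≤ ∫⁻ ω in {ω | ∀ i ≤ n, ξ i ω ∈ A}, (V (ξ n ω) + c) ∂μ := by
  let ext : (Fin (n + 1) → A) → ℕ → α := fun h i => h (Fin.ofNat (n + 1) i)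
  let C : (Fin (n + 1) → A) → Set Ω := fun h => {ω | ∀ i ≤ n, ξ i ω = ext h i}
  have hofNat : ∀ i : Fin (n + 1), Fin.ofNat (n + 1) i = i := fun i => by
    ext
    simp [Fin.ofNat, Nat.mod_eq_of_lt i.isLt]
  have hU : {ω | ∀ i ≤ n, ξ i ω ∈ A} = ⋃ h, C h := by
    ext ω
    simp only [Set.mem_ofPred_eq, Set.mem_iUnion, C, ext]
    constructor
    · intro h
      refine ⟨fun i => ⟨ξ i ω, h i (by omega)⟩, fun i hi => ?_⟩
      simp [Fin.ofNat, Nat.mod_eq_of_lt (Nat.lt_succ_of_le hi)]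
    · rintro ⟨h, hh⟩ i hi
      rw [hh i hi]
      exact Subtype.prop _
  have hCm : ∀ h, MeasurableSet (C h) := by
    intro h
    have : C h = ⋂ i, ⋂ (_ : i ≤ n), ξ i ⁻¹' {ext h i} := by ext; simp [C]
    rw [this]
    exact MeasurableSet.iInter fun i => MeasurableSet.iInter fun _ =>
      hξ i (measurableSet_singleton _)
  have hdisj : Pairwise (Function.onFun Disjoint C) := by
    intro h h' hne
    refine Set.disjoint_left.2 fun ω hω hω' => hne ?_
    funext i
    have := (hω i (by omega)).symm.trans (hω' i (by omega))
    simp only [ext, hofNat] at this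
    exact Subtype.ext this
  rw [hU, lintegral_iUnion hCm hdisj, lintegral_iUnion hCm hdisj]
  exact ENNReal.tsum_le_tsum fun h =>
    setLIntegral_cylinder_succ_le hξ hstep hdrift n (ext h)

/-- Doob's maximal inequality for a function of a Markov chain with drift at most `c`. -/
lemma mul_measure_exceed_add_setLIntegral_le (hξ : ∀ t, Measurable (ξ t))
    (hstep : ∀ (t : ℕ) (path : ℕ → α),
      μ {ω | ∀ i ≤ t + 1, ξ i ω = path i}
        = μ {ω | ∀ i ≤ t, ξ i ω = path i} * Q (path t) (path (t + 1)))
    (hdrift : ∀ x, ∑' y, Q x y * V y ≤ V x + c) [IsProbabilityMeasure μ] (a : ℝ≥0∞) (n : ℕ) :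
    a * μ {ω | ∀ i ≤ n, V (ξ i ω) < a}ᶜ
        + ∫⁻ ω in {ω | ∀ i ≤ n, V (ξ i ω) < a}, V (ξ n ω) ∂μ
      ≤ ∫⁻ ω, V (ξ 0 ω) ∂μ + n * c := by
  have hV : Measurable V := measurable_of_countable V
  let G : ℕ → Set Ω := fun n => {ω | ∀ i ≤ n, V (ξ i ω) < a}
  have hGm : ∀ n, MeasurableSet (G n) := by
    intro n
    have : G n = ⋂ i, ⋂ (_ : i ≤ n), (fun ω => V (ξ i ω)) ⁻¹' Set.Iio a := by ext; simp [G]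
    rw [this]
    exact MeasurableSet.iInter fun i => MeasurableSet.iInter fun _ =>
      (hV.comp (hξ i)) measurableSet_Iio
  have hmarkov : ∀ (n : ℕ) (D : Set Ω), MeasurableSet D → (∀ ω ∈ D, a ≤ V (ξ n ω)) →
      a * μ D ≤ ∫⁻ ω in D, V (ξ n ω) ∂μ := by
    intro n D hD h
    rw [← setLIntegral_const]
    exact setLIntegral_mono' hD h
  change a * μ (G n)ᶜ + ∫⁻ ω in G n, V (ξ n ω) ∂μ ≤ _
  induction n with
  | zero =>
    have h := hmarkov 0 (G 0)ᶜ (hGm 0).compl (fun ω hω => by simpa [G] using hω)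
    calc _ ≤ ∫⁻ ω in (G 0)ᶜ, V (ξ 0 ω) ∂μ + ∫⁻ ω in G 0, V (ξ 0 ω) ∂μ := by gcongr
      _ = _ := by
        rw [add_comm, lintegral_add_compl _ (hGm 0)]
        simp
  | succ n ih =>
    have hsub : G (n + 1) ⊆ G n := fun ω hω i hi => hω i (by omega)
    have hDm : MeasurableSet (G n \ G (n + 1)) := (hGm n).diff (hGm (n + 1))
    have hD := hmarkov (n + 1) (G n \ G (n + 1)) hDm (by
      rintro ω ⟨hω, hω'⟩
      by_contra! hlt
      refine hω' fun i hi => ?_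
      rcases Nat.le_succ_iff.1 hi with hi' | rfl
      · exact hω i hi'
      · exact hlt)
    have hcompl : μ (G (n + 1))ᶜ ≤ μ (G n)ᶜ + μ (G n \ G (n + 1)) := by
      refine (measure_mono fun ω hω => ?_).trans (measure_union_le _ _)
      by_cases h : ω ∈ G n
      · exact Or.inr ⟨h, hω⟩
      · exact Or.inl h
    have hsplit : ∫⁻ ω in G n \ G (n + 1), V (ξ (n + 1) ω) ∂μ
        + ∫⁻ ω in G (n + 1), V (ξ (n + 1) ω) ∂μ = ∫⁻ ω in G n, V (ξ (n + 1) ω) ∂μ := by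
      rw [← lintegral_union (hGm _) Set.disjoint_sdiff_left, Set.sdiff_union_of_subset hsub]
    calc a * μ (G (n + 1))ᶜ + ∫⁻ ω in G (n + 1), V (ξ (n + 1) ω) ∂μ
        ≤ a * (μ (G n)ᶜ + μ (G n \ G (n + 1)))
          + ∫⁻ ω in G (n + 1), V (ξ (n + 1) ω) ∂μ := by gcongr
      _ ≤ a * μ (G n)ᶜ + (∫⁻ ω in G n \ G (n + 1), V (ξ (n + 1) ω) ∂μ
          + ∫⁻ ω in G (n + 1), V (ξ (n + 1) ω) ∂μ) := by
        rw [mul_add, add_assoc]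
        gcongr
      _ ≤ a * μ (G n)ᶜ + ∫⁻ ω in G n, (V (ξ n ω) + c) ∂μ := by
        rw [hsplit]
        exact add_le_add_right (setLIntegral_history_succ_le hξ hstep hdrift n {x | V x < a}) _
      _ = a * μ (G n)ᶜ + ∫⁻ ω in G n, V (ξ n ω) ∂μ + c * μ (G n) := by
        rw [lintegral_add_right _ measurable_const, setLIntegral_const, add_assoc]
      _ ≤ ∫⁻ ω, V (ξ 0 ω) ∂μ + n * c + c * 1 := by
        gcongr
        exact prob_le_one
      _ = _ := by
        push_cast
        ring

end Maximal

/-- Lemma 7: for `p ≥ 1/2` and `β ∈ [0,1]`, for every `t ∈ ℕ`,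
`Pr_{β,p}(max_{0≤s≤t} |ξ_s| ≤ 2√10 t^{1/2}) ≥ 0.95 − f₂(ξ₀)/(10 t)`. -/
theorem hybridZone_max_probability_bound
    (β : ℝ) (hβ0 : 0 ≤ β) (hβ1 : β ≤ 1)
    (p : ℝ) (hp : 1 / 2 ≤ p) (hp1 : p ≤ 1)
    (S₀ : Word) (hS₀ : IsConfig S₀)
    {Ω : Type*} [MeasurableSpace Ω] (μ : Measure Ω) [IsProbabilityMeasure μ]
    (ξ : ℕ → Ω → Word) (hchain : IsEVChain β p μ ξ)
    (hinit : ∀ᵐ ω ∂μ, ξ 0 ω = S₀) :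
    ∀ t : ℕ, 0 < t →
      ENNReal.ofReal (0.95 - f2 S₀ / (10 * (t : ℝ))) ≤
        μ {ω | ∀ s ≤ t, (hz (ξ s ω) : ℝ) ≤ 2 * Real.sqrt 10 * Real.sqrt (t : ℝ)} := by
  intro t ht
  have ht' : (0 : ℝ) < t := by exact_mod_cast ht
  have hmax := mul_measure_exceed_add_setLIntegral_le (Q := fun w w' => ENNReal.ofReal (P β p w w'))
    hchain.1 hchain.2 (potential_drift hβ0 hβ1 hp hp1) (ENNReal.ofReal (10 * t)) t
  have hstart : ∫⁻ ω, potential (ξ 0 ω) ∂μ = ENNReal.ofReal (f2 S₀) := by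
    rw [lintegral_congr_ae (hinit.mono fun ω hω => by rw [hω])]
    simp [potential, hS₀, f2_eq_energy]
  set G := {ω | ∀ i ≤ t, potential (ξ i ω) < ENNReal.ofReal (10 * t)} with hG
  have hGm : MeasurableSet G := by
    have : G = ⋂ i, ⋂ (_ : i ≤ t), ξ i ⁻¹' {w | potential w < ENNReal.ofReal (10 * t)} := by
      ext
      simp [hG]
    rw [this]
    exact MeasurableSet.iInter fun i => MeasurableSet.iInter fun _ => hchain.1 i trivial
  have hf2 : 0 ≤ f2 S₀ := by
    rw [f2_eq_energy]
    exact energy_nonneg S₀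
  have hbound : 10 * t * μ.real Gᶜ ≤ f2 S₀ + t * (1 / 2) := by
    rw [hstart] at hmax
    have h := le_self_add.trans hmax
    rw [← ENNReal.ofReal_natCast, ← ENNReal.ofReal_mul ht'.le,
      ← ENNReal.ofReal_add hf2 (by positivity), ← ofReal_measureReal,
      ← ENNReal.ofReal_mul (by positivity), ENNReal.ofReal_le_ofReal_iff (by positivity)] at h
    exact h
  have hsub : G ⊆ {ω | ∀ s ≤ t, (hz (ξ s ω) : ℝ) ≤ 2 * Real.sqrt 10 * Real.sqrt (t : ℝ)} := by
    intro ω hω s hs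
    have h := hω s hs
    unfold potential at h
    split_ifs at h with hc
    · rw [ENNReal.ofReal_lt_ofReal_iff (by positivity)] at h
      have hlen := sq_length_le_energy hc
      refine abs_le_of_sq_le_sq' ?_ (by positivity) |>.2
      rw [mul_pow, mul_pow, Real.sq_sqrt (by norm_num), Real.sq_sqrt ht'.le]
      unfold hz
      linarith
    · simp at h
  refine le_trans ?_ (measure_mono hsub)
  rw [← ofReal_measureReal]
  refine ENNReal.ofReal_le_ofReal ?_
  rw [probReal_compl_eq_one_sub hGm] at hbound
  have hdiv : 10 * t * (f2 S₀ / (10 * t)) = f2 S₀ := by field_simp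
  refine le_of_mul_le_mul_left ?_ (by positivity : (0 : ℝ) < 10 * t)
  rw [mul_sub, hdiv]
  linarith

end EV
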